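/- Let T' be a tree of order n(T') ≥ 2 and let T be the tree obtained from T' by attaching a path P_2 to a vertex that is a support vertex or a semi-support vertex of T'. Then γ_t^{oi}(S(T)) = γ_t^{oi}(S(T')) + 2. -/

import Mathlib

open SimpleGraph

universe u

/-- A total outer-independent dominating set: every vertex has a neighbor in `D`,
and the complement of `D` is an independent set. -/
def IsTOIDS {V : Type u} (G : SimpleGraph V) (D : Set V) : Prop :=
  (∀ v : V, ∃ u ∈ D, G.Adj v u) ∧ ∀ u ∉ D, ∀ w ∉ D, ¬ G.Adj u w

/-- The total outer-independent domination number. -/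
noncomputable def toidNumber {V : Type u} (G : SimpleGraph V) : ℕ :=
  sInf {n : ℕ | ∃ D : Set V, IsTOIDS G D ∧ D.ncard = n}

/-- The subdivision graph: each edge is replaced by a new vertex adjacent exactly to
its two endpoints. -/
def subdivision {V : Type u} (G : SimpleGraph V) : SimpleGraph (V ⊕ G.edgeSet) :=
  SimpleGraph.fromRel fun x y =>
    ∃ (v : V) (e : G.edgeSet), x = Sum.inl v ∧ y = Sum.inr e ∧ v ∈ (e : Sym2 V)

/-- A leaf: a vertex with exactly one neighbor. -/
def IsLeafVert {V : Type u} (G : SimpleGraph V) (v : V) : Prop := ∃! u, G.Adj v u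

/-- A support vertex: a vertex adjacent to a leaf. -/
def IsSupportVert {V : Type u} (G : SimpleGraph V) (v : V) : Prop :=
  ∃ u, G.Adj v u ∧ IsLeafVert G u

/-- A strong support vertex: a vertex adjacent to at least two leaves. -/
def IsStrongSupportVert {V : Type u} (G : SimpleGraph V) (v : V) : Prop :=
  ∃ u w, u ≠ w ∧ G.Adj v u ∧ G.Adj v w ∧ IsLeafVert G u ∧ IsLeafVert G w

/-- A strong leaf: a leaf adjacent to a strong support vertex. -/
def IsStrongLeaf {V : Type u} (G : SimpleGraph V) (v : V) : Prop :=
  IsLeafVert G v ∧ ∃ u, G.Adj v u ∧ IsStrongSupportVert G u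

/-- A weak leaf: a leaf that is not a strong leaf. -/
def IsWeakLeaf {V : Type u} (G : SimpleGraph V) (v : V) : Prop :=
  IsLeafVert G v ∧ ¬ IsStrongLeaf G v

/-- A semi-support vertex: neither a leaf nor a support vertex, but adjacent to a
support vertex. -/
def IsSemiSupportVert {V : Type u} (G : SimpleGraph V) (v : V) : Prop :=
  ¬ IsLeafVert G v ∧ ¬ IsSupportVert G v ∧ ∃ u, G.Adj v u ∧ IsSupportVert G u

/-- The number of leaves, with the convention that `P₂` has exactly one leaf. -/
noncomputable def leafCount {V : Type u} (G : SimpleGraph V) : ℕ :=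
  if Nat.card V = 2 then 1 else {v | IsLeafVert G v}.ncard

/-- The number of support vertices, with the convention that `P₂` has exactly one
support vertex. -/
noncomputable def supportCount {V : Type u} (G : SimpleGraph V) : ℕ :=
  if Nat.card V = 2 then 1 else {v | IsSupportVert G v}.ncard

/-- The graph obtained from `G` by attaching a path `P_r` to the vertex `v`:
the new vertices form a path `p₀ p₁ ⋯ p_{r-1}` and `v` is joined to the end `p₀`. -/
def attachPath {V : Type u} (G : SimpleGraph V) (v : V) (r : ℕ) :
    SimpleGraph (V ⊕ Fin r) :=
  SimpleGraph.fromRel fun x y =>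
    (∃ a b, x = Sum.inl a ∧ y = Sum.inl b ∧ G.Adj a b) ∨
    (∃ i j : Fin r, x = Sum.inr i ∧ y = Sum.inr j ∧ (j : ℕ) = (i : ℕ) + 1) ∨
    (∃ i : Fin r, x = Sum.inl v ∧ y = Sum.inr i ∧ (i : ℕ) = 0)

/-- The graph obtained from `G` by adding a disjoint copy of the tree `Q_r`
(`r` paths `P₃` joined to a central vertex) and identifying the central vertex
of `Q_r` with the vertex `v` of `G`. -/
def attachQ {V : Type u} (G : SimpleGraph V) (v : V) (r : ℕ) :
    SimpleGraph (V ⊕ Fin r × Fin 3) :=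
  SimpleGraph.fromRel fun x y =>
    (∃ a b, x = Sum.inl a ∧ y = Sum.inl b ∧ G.Adj a b) ∨
    (∃ i : Fin r, x = Sum.inl v ∧ y = Sum.inr (i, 0)) ∨
    (∃ (i : Fin r) (j k : Fin 3),
      x = Sum.inr (i, j) ∧ y = Sum.inr (i, k) ∧ (k : ℕ) = (j : ℕ) + 1)

/-- The family `F`: all trees obtainable from `P₂` by repeatedly
(F1) attaching `P₁` to a support vertex, (F2) attaching `P₂` to a support or
semi-support vertex, (F3) attaching `P₃` to a weak leaf. -/
inductive InFamilyF : {W : Type u} → SimpleGraph W → Prop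
  | base {W : Type u} (G : SimpleGraph W) (e : G ≃g SimpleGraph.pathGraph 2) :
      InFamilyF G
  | op1 {W : Type u} {G' : SimpleGraph W} {v : W} (hv : IsSupportVert G' v)
      (hF : InFamilyF G') {U : Type u} (G : SimpleGraph U)
      (e : G ≃g attachPath G' v 1) : InFamilyF G
  | op2 {W : Type u} {G' : SimpleGraph W} {v : W}
      (hv : IsSupportVert G' v ∨ IsSemiSupportVert G' v)
      (hF : InFamilyF G') {U : Type u} (G : SimpleGraph U)
      (e : G ≃g attachPath G' v 2) : InFamilyF G
  | op3 {W : Type u} {G' : SimpleGraph W} {v : W} (hv : IsWeakLeaf G' v)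
      (hF : InFamilyF G') {U : Type u} (G : SimpleGraph U)
      (e : G ≃g attachPath G' v 3) : InFamilyF G

/-- The family `𝒯`: all trees obtainable from `P₂` by repeatedly
(O1) attaching `P₁` to a support vertex, (O2) attaching `P₃` to a support vertex or a
weak leaf, (O3) adding a copy of `Q_r` (`r ≥ 2`) identifying its central vertex with a
weak leaf. -/
inductive InFamilyT : {W : Type u} → SimpleGraph W → Prop
  | base {W : Type u} (G : SimpleGraph W) (e : G ≃g SimpleGraph.pathGraph 2) :
      InFamilyT G
  | op1 {W : Type u} {G' : SimpleGraph W} {v : W} (hv : IsSupportVert G' v)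
      (hF : InFamilyT G') {U : Type u} (G : SimpleGraph U)
      (e : G ≃g attachPath G' v 1) : InFamilyT G
  | op2 {W : Type u} {G' : SimpleGraph W} {v : W}
      (hv : IsSupportVert G' v ∨ IsWeakLeaf G' v)
      (hF : InFamilyT G') {U : Type u} (G : SimpleGraph U)
      (e : G ≃g attachPath G' v 3) : InFamilyT G
  | op3 {W : Type u} {G' : SimpleGraph W} {v : W} (hv : IsWeakLeaf G' v)
      (hF : InFamilyT G') {r : ℕ} (hr : 2 ≤ r) {U : Type u} (G : SimpleGraph U)
      (e : G ≃g attachQ G' v r) : InFamilyT G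

/-- A total outer-independent dominating set of the subdivision of `G`, described by its set `A`
of original vertices and its set `B` of subdivided edges. -/
structure IsSubdivisionTOIDPair {V : Type u} (G : SimpleGraph V) (A : Set V)
    (B : Set (Sym2 V)) : Prop where
  subset : B ⊆ G.edgeSet
  exists_edge : ∀ v, ∃ w, G.Adj v w ∧ s(v, w) ∈ B
  cover : ∀ a b, G.Adj a b → a ∈ A ∨ b ∈ A
  incidence : ∀ a b, G.Adj a b → a ∈ A ∨ s(a, b) ∈ B

section Subdivision

variable {V : Type u} {G : SimpleGraph V}

theorem subdivision_adj_inl_inr {v : V} {e : G.edgeSet} :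
    (subdivision G).Adj (Sum.inl v) (Sum.inr e) ↔ v ∈ (e : Sym2 V) := by
  simp [subdivision]

theorem subdivision_not_adj_inl_inl {v w : V} :
    ¬ (subdivision G).Adj (Sum.inl v) (Sum.inl w) := by
  simp [subdivision]

theorem subdivision_not_adj_inr_inr {e f : G.edgeSet} :
    ¬ (subdivision G).Adj (Sum.inr e) (Sum.inr f) := by
  simp [subdivision]

theorem IsSubdivisionTOIDPair.isTOIDS {A : Set V} {B : Set (Sym2 V)}
    (h : IsSubdivisionTOIDPair G A B) :
    IsTOIDS (subdivision G) (Sum.inl '' A ∪ Sum.inr '' {e : G.edgeSet | (e : Sym2 V) ∈ B}) := by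
  have key : ∀ (a : V) (e : G.edgeSet), a ∈ (e : Sym2 V) → a ∈ A ∨ (e : Sym2 V) ∈ B := by
    rintro a ⟨e, he⟩ hae
    obtain ⟨b, rfl⟩ := Sym2.mem_iff_exists.1 hae
    exact h.incidence a b he
  refine ⟨?_, ?_⟩
  · rintro (v | ⟨e, he⟩)
    · obtain ⟨w, hw, hB⟩ := h.exists_edge v
      exact ⟨Sum.inr ⟨s(v, w), hw⟩, by simp [hB], subdivision_adj_inl_inr.2 (by simp)⟩
    · induction e with
      | h a b =>
        rcases h.cover a b he with ha | hb
        · exact ⟨Sum.inl a, by simp [ha], (subdivision_adj_inl_inr.2 (by simp)).symm⟩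
        · exact ⟨Sum.inl b, by simp [hb], (subdivision_adj_inl_inr.2 (by simp)).symm⟩
  · rintro (a | e) hx (b | f) hy hadj
    · exact subdivision_not_adj_inl_inl hadj
    · have := key a f (subdivision_adj_inl_inr.1 hadj)
      simp_all
    · have := key b e (subdivision_adj_inl_inr.1 hadj.symm)
      simp_all
    · exact subdivision_not_adj_inr_inr hadj

theorem IsTOIDS.isSubdivisionTOIDPair {D : Set (V ⊕ G.edgeSet)}
    (h : IsTOIDS (subdivision G) D) :
    IsSubdivisionTOIDPair G (Sum.inl ⁻¹' D) (Subtype.val '' (Sum.inr ⁻¹' D)) where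
  subset := by
    rintro _ ⟨e, -, rfl⟩
    exact e.2
  exists_edge v := by
    obtain ⟨u | ⟨e, he⟩, hu, hadj⟩ := h.1 (Sum.inl v)
    · exact (subdivision_not_adj_inl_inl hadj).elim
    · obtain ⟨w, rfl⟩ := Sym2.mem_iff_exists.1 (subdivision_adj_inl_inr.1 hadj)
      exact ⟨w, he, _, hu, rfl⟩
  cover a b hab := by
    obtain ⟨u | f, hu, hadj⟩ := h.1 (Sum.inr ⟨s(a, b), hab⟩)
    · rcases Sym2.mem_iff.1 (subdivision_adj_inl_inr.1 hadj.symm) with rfl | rfl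
      · exact Or.inl hu
      · exact Or.inr hu
    · exact (subdivision_not_adj_inr_inr hadj).elim
  incidence a b hab := by
    by_contra! hcon
    refine h.2 (Sum.inl a) hcon.1 (Sum.inr ⟨s(a, b), hab⟩) (fun hD => hcon.2 ⟨_, hD, rfl⟩) ?_
    exact subdivision_adj_inl_inr.2 (by simp)

theorem IsSubdivisionTOIDPair.toidNumber_le [Finite V] {A : Set V} {B : Set (Sym2 V)}
    (h : IsSubdivisionTOIDPair G A B) : toidNumber (subdivision G) ≤ A.ncard + B.ncard := by
  rw [toidNumber]
  have hle : sInf {n : ℕ | ∃ D, IsTOIDS (subdivision G) D ∧ D.ncard = n} ≤ _ :=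
    Nat.sInf_le ⟨_, h.isTOIDS, rfl⟩
  refine hle.trans ((Set.ncard_union_le _ _).trans ?_)
  refine Nat.add_le_add Set.ncard_image_le ((Set.ncard_image_le (Set.toFinite _)).trans ?_)
  rw [← Set.ncard_image_of_injective _ Subtype.val_injective]
  refine Set.ncard_le_ncard ?_
  rintro _ ⟨e, he, rfl⟩
  exact he

theorem IsSubdivisionTOIDPair.exists_eq_toidNumber [Finite V] {A : Set V} {B : Set (Sym2 V)}
    (h : IsSubdivisionTOIDPair G A B) :
    ∃ A' B', IsSubdivisionTOIDPair G A' B' ∧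
      A'.ncard + B'.ncard = toidNumber (subdivision G) := by
  obtain ⟨D, hD, hcard⟩ := Nat.sInf_mem
    (s := {n : ℕ | ∃ D, IsTOIDS (subdivision G) D ∧ D.ncard = n}) ⟨_, _, h.isTOIDS, rfl⟩
  refine ⟨_, _, hD.isSubdivisionTOIDPair, ?_⟩
  rw [toidNumber, ← hcard, Set.ncard_image_of_injective _ Subtype.val_injective,
    ← Set.ncard_image_of_injective (Sum.inl ⁻¹' D) (Sum.inl_injective (β := G.edgeSet)),
    ← Set.ncard_image_of_injective (Sum.inr ⁻¹' D) (Sum.inr_injective (α := V)),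
    ← Set.ncard_union_eq]
  · rw [Set.image_preimage_inl_union_image_preimage_inr]
  · exact Set.disjoint_image_inl_image_inr

/-- A pair can be modified, without increasing its size, to contain any given support vertex. -/
theorem IsSubdivisionTOIDPair.exists_mem_of_isSupportVert {A : Set V} {B : Set (Sym2 V)}
    (h : IsSubdivisionTOIDPair G A B) {v : V} (hv : IsSupportVert G v) :
    ∃ A', IsSubdivisionTOIDPair G A' B ∧ v ∈ A' ∧ A'.ncard ≤ A.ncard := by
  by_cases hvA : v ∈ A
  · exact ⟨A, h, hvA, le_rfl⟩
  obtain ⟨u, hvu, hu⟩ := hv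
  have huniq : ∀ w, G.Adj u w → w = v := fun w hw => hu.unique hw hvu.symm
  have huA : u ∈ A := (h.cover v u hvu).resolve_left hvA
  have huB : s(u, v) ∈ B := by
    obtain ⟨w, hw, hB⟩ := h.exists_edge u
    rwa [huniq w hw] at hB
  refine ⟨insert v (A \ {u}), ⟨h.subset, h.exists_edge, fun a b hab => ?_, fun a b hab => ?_⟩,
    Set.mem_insert _ _, (Set.ncard_exchange hvA huA).le⟩
  · by_cases ha : a = u
    · subst ha
      simp [huniq b hab]
    by_cases hb : b = u
    · subst hb
      simp [huniq a hab.symm]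
    simpa [ha, hb] using (h.cover a b hab).imp Or.inr Or.inr
  · by_cases ha : a = u
    · subst ha
      rw [huniq b hab]
      exact Or.inr huB
    · simpa [ha] using (h.incidence a b hab).imp_left Or.inr

theorem IsSubdivisionTOIDPair.exists_mem_of_isSemiSupportVert [Finite V] {A : Set V} {B : Set (Sym2 V)}
    (h : IsSubdivisionTOIDPair G A B) {v : V} (hv : IsSemiSupportVert G v) :
    ∃ A' B', IsSubdivisionTOIDPair G A' B' ∧ v ∈ A' ∧
      A'.ncard + B'.ncard ≤ A.ncard + B.ncard := by
  obtain ⟨hleaf, -, w, hvw, hw⟩ := hv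
  obtain ⟨A, hA, hwA, hcard⟩ := h.exists_mem_of_isSupportVert hw
  by_cases hvA : v ∈ A
  · exact ⟨A, B, hA, hvA, by lia⟩
  obtain ⟨x, hwx, hx⟩ := hw
  have hxv : x ≠ v := by
    rintro rfl
    exact hleaf hx
  have hxB : s(w, x) ∈ B := by
    obtain ⟨y, hy, hB⟩ := hA.exists_edge x
    rw [hx.unique hy hwx.symm] at hB
    rwa [Sym2.eq_swap]
  obtain ⟨z, hvz, hzw⟩ : ∃ z, G.Adj v z ∧ z ≠ w := by
    by_contra! hcon
    exact hleaf ⟨w, hvw, hcon⟩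
  have hvB : ∀ y, G.Adj v y → s(v, y) ∈ B := fun y hy => (hA.incidence v y hy).resolve_left hvA
  refine ⟨insert v A, B \ {s(v, w)}, ⟨Set.sdiff_subset.trans hA.subset, fun a => ?_,
    fun a b hab => ?_, fun a b hab => ?_⟩, Set.mem_insert _ _, ?_⟩
  · by_cases hav : a = v
    · subst hav
      exact ⟨z, hvz, hvB z hvz, by simp [hzw, hvw.ne]⟩
    by_cases haw : a = w
    · subst haw
      refine ⟨x, hwx, hxB, ?_⟩
      simp [hxv, hvw.ne.symm]
    obtain ⟨b, hb, hB⟩ := hA.exists_edge a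
    exact ⟨b, hb, hB, by simp [hav, haw]⟩
  · exact (hA.cover a b hab).imp (Set.mem_insert_of_mem _) (Set.mem_insert_of_mem _)
  · by_cases hav : a = v
    · exact Or.inl (by simp [hav])
    by_cases haw : a = w
    · subst haw
      exact Or.inl (Set.mem_insert_of_mem _ hwA)
    refine (hA.incidence a b hab).imp (Set.mem_insert_of_mem _) fun hB => ⟨hB, ?_⟩
    simp [hav, haw]
  · have h₁ := Set.ncard_insert_of_notMem hvA
    have h₂ := Set.ncard_sdiff_singleton_add_one (hvB w hvw)
    lia

end Subdivision

section AttachPath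

variable {V : Type u} {G : SimpleGraph V} {v : V}

theorem attachPath_two_adj_inl_inl {a b : V} :
    (attachPath G v 2).Adj (Sum.inl a) (Sum.inl b) ↔ G.Adj a b := by
  simp only [attachPath, SimpleGraph.fromRel_adj]
  constructor
  · rintro ⟨-, h | h⟩
    · simpa using h
    · exact SimpleGraph.Adj.symm (by simpa using h)
  · intro h
    exact ⟨by simpa using h.ne, Or.inl (Or.inl ⟨a, b, rfl, rfl, h⟩)⟩

theorem attachPath_two_adj_inl_inr {a : V} {i : Fin 2} :
    (attachPath G v 2).Adj (Sum.inl a) (Sum.inr i) ↔ a = v ∧ i = 0 := by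
  simp only [attachPath, SimpleGraph.fromRel_adj]
  constructor
  · rintro ⟨-, h | h⟩
    · obtain ⟨_, _, -, hb, -⟩ | ⟨_, _, ha, -⟩ | ⟨j, ha, hb, hj⟩ := h
      · cases hb
      · cases ha
      · cases ha
        cases hb
        exact ⟨rfl, Fin.ext hj⟩
    · simp at h
  · rintro ⟨rfl, rfl⟩
    exact ⟨by simp, Or.inl (Or.inr (Or.inr ⟨0, rfl, rfl, rfl⟩))⟩

theorem attachPath_two_adj_inr_inr {i j : Fin 2} :
    (attachPath G v 2).Adj (Sum.inr i) (Sum.inr j) ↔ i ≠ j := by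
  fin_cases i <;> fin_cases j <;> simp [attachPath]

theorem IsSubdivisionTOIDPair.attachPath_two {A : Set V} {B : Set (Sym2 V)}
    (h : IsSubdivisionTOIDPair G A B) (hv : v ∈ A) :
    IsSubdivisionTOIDPair (attachPath G v 2) (insert (Sum.inr 0) (Sum.inl '' A))
      (insert s(Sum.inr 0, Sum.inr 1) (Sym2.map Sum.inl '' B)) where
  subset := by
    rintro _ (rfl | ⟨e, he, rfl⟩)
    · exact attachPath_two_adj_inr_inr.2 (by decide)
    · induction e with
      | h a b => exact attachPath_two_adj_inl_inl.2 (h.subset he)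
  exists_edge := by
    rintro (a | i)
    · obtain ⟨b, hb, hB⟩ := h.exists_edge a
      exact ⟨Sum.inl b, attachPath_two_adj_inl_inl.2 hb, Or.inr ⟨_, hB, rfl⟩⟩
    · refine ⟨Sum.inr (1 - i), attachPath_two_adj_inr_inr.2 (by decide +revert), Or.inl ?_⟩
      fin_cases i <;> simp
  cover := by
    rintro (a | i) (b | j) hab
    · simpa using h.cover a b (attachPath_two_adj_inl_inl.1 hab)
    · obtain ⟨rfl, rfl⟩ := attachPath_two_adj_inl_inr.1 hab
      simp
    · obtain ⟨rfl, rfl⟩ := attachPath_two_adj_inl_inr.1 hab.symm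
      simp
    · have hij := attachPath_two_adj_inr_inr.1 hab
      have : i = 0 ∨ j = 0 := by lia
      simpa using this
  incidence := by
    rintro (a | i) (b | j) hab
    · refine (h.incidence a b (attachPath_two_adj_inl_inl.1 hab)).imp (fun ha => ?_) fun hB => ?_
      · exact Or.inr ⟨a, ha, rfl⟩
      · exact Or.inr ⟨_, hB, rfl⟩
    · obtain ⟨rfl, rfl⟩ := attachPath_two_adj_inl_inr.1 hab
      simp [hv]
    · obtain ⟨rfl, rfl⟩ := attachPath_two_adj_inl_inr.1 hab.symm
      simp
    · have hij := attachPath_two_adj_inr_inr.1 hab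
      fin_cases i <;> fin_cases j <;> simp_all

/-- Restricting a pair for `attachPath G v 2` to `G`, possibly adding an edge at `v`. -/
theorem IsSubdivisionTOIDPair.exists_of_attachPath_two [Finite V] {A : Set (V ⊕ Fin 2)}
    {B : Set (Sym2 (V ⊕ Fin 2))} (h : IsSubdivisionTOIDPair (attachPath G v 2) A B)
    {u : V} (hu : G.Adj v u) :
    ∃ A' B', IsSubdivisionTOIDPair G A' B' ∧ A'.ncard + B'.ncard + 2 ≤ A.ncard + B.ncard := by
  have hinj : Function.Injective (Sym2.map (Sum.inl : V → V ⊕ Fin 2)) :=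
    Sym2.map.injective Sum.inl_injective
  set A' : Set V := Sum.inl ⁻¹' A
  set B' : Set (Sym2 V) := Sym2.map Sum.inl ⁻¹' B
  have hsub : B' ⊆ G.edgeSet := by
    intro e he
    induction e with
    | h a b => exact attachPath_two_adj_inl_inl.1 (h.subset he)
  have hcover : ∀ a b, G.Adj a b → a ∈ A' ∨ b ∈ A' := fun a b hab =>
    h.cover _ _ (attachPath_two_adj_inl_inl.2 hab)
  have hinc : ∀ a b, G.Adj a b → a ∈ A' ∨ s(a, b) ∈ B' := fun a b hab =>
    h.incidence _ _ (attachPath_two_adj_inl_inl.2 hab)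
  have hedge : ∀ a, (∃ w, G.Adj a w ∧ s(a, w) ∈ B') ∨
      a = v ∧ s(Sum.inl v, Sum.inr 0) ∈ B := by
    intro a
    obtain ⟨w | i, hw, hB⟩ := h.exists_edge (Sum.inl a)
    · exact Or.inl ⟨w, attachPath_two_adj_inl_inl.1 hw, hB⟩
    · obtain ⟨rfl, rfl⟩ := attachPath_two_adj_inl_inr.1 hw
      exact Or.inr ⟨rfl, hB⟩
  have hend : s(Sum.inr 0, Sum.inr 1) ∈ B := by
    obtain ⟨w | i, hw, hB⟩ := h.exists_edge (Sum.inr 1)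
    · simpa using attachPath_two_adj_inl_inr.1 hw.symm
    · have := attachPath_two_adj_inr_inr.1 hw
      obtain rfl : i = 0 := by lia
      rwa [Sym2.eq_swap]
  have hAcard : A'.ncard + 1 ≤ A.ncard := by
    obtain ⟨i, hi⟩ : ∃ i : Fin 2, Sum.inr i ∈ A := by
      rcases h.cover (Sum.inr 0) (Sum.inr 1) (attachPath_two_adj_inr_inr.2 (by decide))
        with h0 | h1
      · exact ⟨0, h0⟩
      · exact ⟨1, h1⟩
    rw [← Set.ncard_image_of_injective A' (Sum.inl_injective (β := Fin 2)),
      ← Set.ncard_insert_of_notMem (a := Sum.inr i) (by simp)]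
    exact Set.ncard_le_ncard (Set.insert_subset hi (Set.image_preimage_subset _ _))
  have hend_notMem : s(Sum.inr (0 : Fin 2), Sum.inr 1) ∉ Sym2.map Sum.inl '' B' := by
    rintro ⟨e, -, he⟩
    induction e with
    | h a b => simp at he
  have hBcard : (insert s(Sum.inr (0 : Fin 2), Sum.inr 1) (Sym2.map Sum.inl '' B')).ncard =
      B'.ncard + 1 := by
    rw [Set.ncard_insert_of_notMem hend_notMem, Set.ncard_image_of_injective _ hinj]
  have hBsub : insert s(Sum.inr 0, Sum.inr 1) (Sym2.map Sum.inl '' B') ⊆ B :=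
    Set.insert_subset hend (Set.image_preimage_subset _ _)
  by_cases hmid : s(Sum.inl v, Sum.inr 0) ∈ B
  · refine ⟨A', insert s(v, u) B', ⟨Set.insert_subset hu hsub, fun a => ?_, hcover,
      fun a b hab => (hinc a b hab).imp_right (Set.mem_insert_of_mem _)⟩, ?_⟩
    · rcases hedge a with ⟨w, hw, hB⟩ | ⟨rfl, -⟩
      · exact ⟨w, hw, Set.mem_insert_of_mem _ hB⟩
      · exact ⟨u, hu, Set.mem_insert _ _⟩
    · have hmid_notMem : s(Sum.inl v, Sum.inr (0 : Fin 2)) ∉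
          insert s(Sum.inr 0, Sum.inr 1) (Sym2.map Sum.inl '' B') := by
        rintro (he | ⟨e, -, he⟩)
        · simp at he
        · induction e with
          | h a b => simp at he
      have h₁ := Set.ncard_insert_of_notMem hmid_notMem
      have h₂ := Set.ncard_le_ncard (Set.insert_subset hmid hBsub)
      have h₃ := Set.ncard_insert_le s(v, u) B'
      lia
  · refine ⟨A', B', ⟨hsub, fun a => (hedge a).resolve_right fun hh => hmid hh.2, hcover, hinc⟩, ?_⟩
    have h₁ := Set.ncard_le_ncard hBsub
    lia

end AttachPath

theorem attach_P2_to_support_or_semisupport {V : Type u} [Fintype V]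
    (T' : SimpleGraph V) (hT' : T'.IsTree) (hn : 2 ≤ Nat.card V) (v : V)
    (hv : IsSupportVert T' v ∨ IsSemiSupportVert T' v) :
    toidNumber (subdivision (attachPath T' v 2)) = toidNumber (subdivision T') + 2 := by
  have : Nontrivial V := Finite.one_lt_card_iff_nontrivial.1 hn
  have hadj : ∀ a, ∃ b, T'.Adj a b := hT'.connected.preconnected.exists_adj_of_nontrivial
  have huniv : IsSubdivisionTOIDPair T' Set.univ T'.edgeSet :=
    ⟨subset_rfl, fun a => (hadj a).imp fun b hb => ⟨hb, hb⟩, by simp, by simp⟩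
  obtain ⟨A₀, B₀, h₀, hcard₀⟩ := huniv.exists_eq_toidNumber
  obtain ⟨A, B, h, hvA, hcard⟩ : ∃ A B, IsSubdivisionTOIDPair T' A B ∧ v ∈ A ∧
      A.ncard + B.ncard ≤ A₀.ncard + B₀.ncard := by
    rcases hv with hv | hv
    · obtain ⟨A, h, hvA, hcard⟩ := h₀.exists_mem_of_isSupportVert hv
      exact ⟨A, B₀, h, hvA, by lia⟩
    · exact h₀.exists_mem_of_isSemiSupportVert hv
  have hattach := h.attachPath_two hvA
  apply le_antisymm
  · have h₁ := hattach.toidNumber_le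
    have h₂ := Set.ncard_insert_le (Sum.inr (0 : Fin 2)) (Sum.inl '' A)
    have h₃ := Set.ncard_insert_le s(Sum.inr (0 : Fin 2), Sum.inr 1) (Sym2.map Sum.inl '' B)
    have h₄ := Set.ncard_image_le (f := (Sum.inl : V → V ⊕ Fin 2)) A.toFinite
    have h₅ := Set.ncard_image_le (f := Sym2.map (Sum.inl : V → V ⊕ Fin 2)) B.toFinite
    lia
  · obtain ⟨A₁, B₁, h₁, hcard₁⟩ := hattach.exists_eq_toidNumber
    obtain ⟨u, hu⟩ := hadj v
    obtain ⟨A₂, B₂, h₂, hcard₂⟩ := h₁.exists_of_attachPath_two hu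
    have := h₂.toidNumber_le
    lia
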